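/- Let d ≥ 0 be an integer and a, b, c elements of an algebraically closed field F of characteristic zero. Let A be the (d+1)×(d+1) lower bidiagonal matrix with diagonal entries θ_i = (a + d/2 - i)(a + d/2 - i + 1) for 0 ≤ i ≤ d and subdiagonal entries all equal to 1, and let B be the upper bidiagonal matrix with diagonal entries θ*_i = (b + d/2 - i)(b + d/2 - i + 1) and superdiagonal entries φ_i = i(i - d - 1)(a + b + c + d/2 - i + 2)(a + b - c + d/2 - i + 1) for 1 ≤ i ≤ d. If a + b + c + 1, -a + b + c, a - b + c, and a + b - c all avoid the set {d/2 - i : i = 1, ..., d}, then the only subspaces of F^{d+1} invariant under both A and B are {0} and F^{d+1}. -/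

import Mathlib

open Finset in
/-- The terms of the (denominator-free) Pfaff-Saalschütz sum. -/
def saalT {F : Type*} [Field F] (p q C E : F) (n m : ℕ) : F :=
  (-1) ^ m * (n.choose m : F) * (∏ i ∈ range m, ((p + i) * (q + i))) *
    ((∏ i ∈ range (n - m), (C + m + i)) * ∏ i ∈ range (n - m), (E - i))

open Finset in
theorem saalT_ratio {F : Type*} [Field F] (p q C E : F) (n m : ℕ) (h : m < n) :
    saalT p q C E n (m + 1) * ((m + 1) * (C + m) * (E - n + m + 1)) =
      (m - n) * (p + m) * (q + m) * saalT p q C E n m := by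
  obtain ⟨r, rfl⟩ : ∃ r, n = m + 1 + r := ⟨n - (m + 1), by omega⟩
  have h1 : m + 1 + r - (m + 1) = r := by omega
  have h2 : m + 1 + r - m = r + 1 := by omega
  have h3 : ∏ i ∈ range (r + 1), (C + m + i) =
      (∏ i ∈ range r, (C + (m + 1 : ℕ) + i)) * (C + m) := by
    rw [prod_range_succ']
    congr 1
    · apply prod_congr rfl
      intro i _
      push_cast; ring
    · simp
  have h4 : (((m + 1 + r).choose (m + 1) : ℕ) : F) * (m + 1) =
      ((m + 1 + r).choose m : ℕ) * (r + 1) := by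
    have := Nat.choose_succ_right_eq (m + 1 + r) m
    rw [h2] at this
    have h5 := congrArg (Nat.cast : ℕ → F) this
    push_cast at h5
    exact h5
  unfold saalT
  rw [h1, h2, h3, prod_range_succ, prod_range_succ (n := r), pow_succ]
  push_cast
  linear_combination (-1 * (-1) ^ m * (∏ i ∈ range m, ((p + (i : F)) * (q + i))) * (p + m) * (q + m) *
    (∏ i ∈ range r, (C + (m + 1) + (i : F))) * (∏ i ∈ range r, (E - (i : F))) * (C + m) * (E - r)) * h4

open Finset in
theorem saalT_zero {F : Type*} [Field F] (p q C E : F) (n : ℕ) :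
    saalT p q C E (n + 1) 0 = saalT p q C E n 0 * ((C + n) * (E - n)) := by
  simp [saalT, prod_range_succ]
  ring

open Finset in
theorem saalT_succ {F : Type*} [Field F] (p q C E : F) (hE : C + E = p + q) (n m : ℕ)
    (h : m ≤ n) :
    saalT p q C E (n + 1) (m + 1) =
      saalT p q C E n (m + 1) * ((C + n + (m + 1)) * (E - n + (m + 1))) -
      saalT p q C E n m * ((p + m) * (q + m)) := by
  rcases h.eq_or_lt with rfl | h
  · simp [saalT, prod_range_succ, pow_succ]
    ring
  obtain ⟨r, rfl⟩ : ∃ r, n = m + 1 + r := ⟨n - (m + 1), by omega⟩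
  have h1 : m + 1 + r - (m + 1) = r := by omega
  have h2 : m + 1 + r - m = r + 1 := by omega
  have h2' : m + 1 + r + 1 - (m + 1) = r + 1 := by omega
  have h3 : ∏ i ∈ range (r + 1), (C + m + i) =
      (∏ i ∈ range r, (C + (m + 1 : ℕ) + i)) * (C + m) := by
    rw [prod_range_succ']
    congr 1
    · apply prod_congr rfl
      intro i _
      push_cast; ring
    · simp
  have h4 : (((m + 1 + r).choose (m + 1) : ℕ) : F) * (m + 1) =
      ((m + 1 + r).choose m : ℕ) * (r + 1) := by
    have := Nat.choose_succ_right_eq (m + 1 + r) m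
    rw [h2] at this
    have h5 := congrArg (Nat.cast : ℕ → F) this
    push_cast at h5
    exact h5
  unfold saalT
  rw [h1, h2, h2', h3, prod_range_succ, prod_range_succ (n := r), prod_range_succ (n := r),
    pow_succ, Nat.choose_succ_succ]
  push_cast
  linear_combination ((-1) ^ m * (∏ i ∈ range m, ((p + (i : F)) * (q + i))) * (p + m) * (q + m) *
    (∏ i ∈ range r, (C + (m + 1) + (i : F))) * (∏ i ∈ range r, (E - (i : F)))) * (E - r) * h4

open Finset in
theorem saal_sum {F : Type*} [Field F] (p q C E : F) (hE : C + E = p + q) (n : ℕ) :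
    ∑ m ∈ range (n + 1), saalT p q C E n m =
      ∏ k ∈ range n, (-((C - p + k) * (C - q + k))) := by
  induction n with
  | zero => simp [saalT]
  | succ n ih =>
    have key : ∀ m ∈ range (n + 1), saalT p q C E (n + 1) (m + 1) =
      (saalT p q C E n (m + 1) * (-((C - p + n) * (C - q + n)))) +
      (saalT p q C E n (m + 1) * ((p + (m + 1 : ℕ)) * (q + (m + 1 : ℕ))) -
      saalT p q C E n m * ((p + m) * (q + m))) := by
      intro m hm
      rw [saalT_succ p q C E hE n m (by simpa [Nat.lt_succ_iff] using hm)]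
      obtain rfl : E = p + q - C := by linear_combination hE
      push_cast
      ring
    have hz : saalT p q C E n (n + 1) = 0 := by simp [saalT]
    rw [sum_range_succ', sum_congr rfl key, sum_add_distrib, sum_range_sub
      (fun m => saalT p q C E n m * ((p + m) * (q + m))), ← sum_mul, prod_range_succ, ← ih,
      sum_range_succ (n := n), sum_range_succ' _ n, saalT_zero, hz]
    obtain rfl : E = p + q - C := by linear_combination hE
    push_cast
    ring

open Finset in
theorem saal_ne_zero {F : Type*} [Field F] [CharZero F] (p q C E : F) (hE : C + E = p + q) (n : ℕ)
    (t : ℕ → F) (h0 : t 0 ≠ 0)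
    (ht : ∀ m < n, t (m + 1) * ((m + 1) * (C + m) * (E - n + m + 1)) =
      (m - n) * (p + m) * (q + m) * t m)
    (h1 : ∀ m < n, C + (m : F) ≠ 0) (h2 : ∀ m < n, E - (m : F) ≠ 0)
    (h3 : ∀ m < n, C - p + (m : F) ≠ 0) (h4 : ∀ m < n, C - q + (m : F) ≠ 0) :
    ∑ m ∈ range (n + 1), t m ≠ 0 := by
  have key : ∀ m ≤ n, saalT p q C E n m * t 0 = t m * saalT p q C E n 0 := by
    intro m
    induction m with
    | zero => intro _; ring
    | succ m ih =>
      intro hm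
      have ih := ih (by omega)
      have e1 := ht m (by omega)
      have e2 := saalT_ratio p q C E n m (by omega)
      have hne : ((m : F) + 1) * (C + m) * (E - n + m + 1) ≠ 0 := by
        have := h2 (n - (m + 1)) (by omega)
        rw [Nat.cast_sub hm] at this
        refine mul_ne_zero (mul_ne_zero (by exact_mod_cast Nat.succ_ne_zero m) (h1 m (by omega))) ?_
        intro h; apply this; push_cast; linear_combination h
      apply mul_right_cancel₀ hne
      linear_combination t 0 * e2 - saalT p q C E n 0 * e1 + (m - n) * (p + m) * (q + m) * ih
  intro hs
  have : (∑ m ∈ range (n + 1), saalT p q C E n m) * t 0 = 0 := by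
    rw [sum_mul, sum_congr rfl (fun m hm => key m (by simpa [Nat.lt_succ_iff] using hm)),
      ← sum_mul, hs, zero_mul]
  rw [saal_sum p q C E hE] at this
  rcases mul_eq_zero.1 this with h | h
  · rw [prod_eq_zero_iff] at h
    obtain ⟨k, hk, h⟩ := h
    rw [neg_eq_zero, mul_eq_zero] at h
    rw [mem_range] at hk
    exact h.elim (h3 k hk) (h4 k hk)
  · exact h0 h

/-- Extension of a vector by zero. -/
def vext {F : Type*} [Field F] {d : ℕ} (x : Fin (d + 1) → F) (i : ℕ) : F :=
  if h : i < d + 1 then x ⟨i, h⟩ else 0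

theorem vext_coe {F : Type*} [Field F] {d : ℕ} (x : Fin (d + 1) → F) (i : Fin (d + 1)) :
    vext x i = x i := by
  rw [vext, dif_pos i.2]

theorem vext_sum {F : Type*} [Field F] {d : ℕ} (x : Fin (d + 1) → F) (M : ℕ → F) :
    ∑ j : Fin (d + 1), M j * x j = ∑ j ∈ Finset.range (d + 1), M j * vext x j := by
  rw [Finset.sum_range]
  simp [vext_coe]

theorem vext_A {F : Type*} [Field F] {d : ℕ} (θ : ℕ → F) (x : Fin (d + 1) → F) (i : ℕ)
    (hi : i < d + 1) :
    vext ((Matrix.of fun i j : Fin (d + 1) =>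
      if (i : ℕ) = (j : ℕ) then θ i else if (i : ℕ) = (j : ℕ) + 1 then 1 else 0).mulVec x) i =
      θ i * vext x i + if i = 0 then 0 else vext x (i - 1) := by
  rw [vext, dif_pos hi]
  simp only [Matrix.mulVec, dotProduct, Matrix.of_apply]
  rw [vext_sum x (fun j => if i = j then θ i else if i = j + 1 then 1 else 0)]
  have : ∀ j ∈ Finset.range (d + 1),
      (if i = j then θ i else if i = j + 1 then 1 else 0) * vext x j =
      (if i = j then θ i * vext x j else 0) + (if i = j + 1 then vext x j else 0) := by
    intro j _
    split_ifs <;> first | omega | simp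
  rw [Finset.sum_congr rfl this, Finset.sum_add_distrib, Finset.sum_ite_eq]
  congr 1
  · simp [hi]
  · rcases i with _ | i
    · simp
    · simp; intro h; omega

theorem vext_B {F : Type*} [Field F] {d : ℕ} (θ φ : ℕ → F) (x : Fin (d + 1) → F) (i : ℕ)
    (hi : i < d + 1) :
    vext ((Matrix.of fun i j : Fin (d + 1) =>
      if (i : ℕ) = (j : ℕ) then θ i else if (j : ℕ) = (i : ℕ) + 1 then φ j else 0).mulVec x) i =
      θ i * vext x i + φ (i + 1) * vext x (i + 1) := by
  rw [vext, dif_pos hi]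
  simp only [Matrix.mulVec, dotProduct, Matrix.of_apply]
  rw [vext_sum x (fun j => if i = j then θ i else if j = i + 1 then φ j else 0)]
  have : ∀ j ∈ Finset.range (d + 1),
      (if i = j then θ i else if j = i + 1 then φ j else 0) * vext x j =
      (if i = j then θ i * vext x j else 0) + (if j = i + 1 then φ j * vext x j else 0) := by
    intro j _
    split_ifs <;> first | omega | simp
  rw [Finset.sum_congr rfl this, Finset.sum_add_distrib, Finset.sum_ite_eq, Finset.sum_ite_eq']
  congr 1
  · simp [hi]
  · by_cases h : i + 1 < d + 1
    · simp [h]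
    · simp [vext, h]

theorem top_of_v0 {F : Type*} [Field F] {d : ℕ} (θ : ℕ → F) (U : Submodule F (Fin (d + 1) → F))
    (hU : ∀ v ∈ U, (Matrix.of fun i j : Fin (d + 1) =>
      if (i : ℕ) = (j : ℕ) then θ i else
        if (i : ℕ) = (j : ℕ) + 1 then (1 : F) else 0).mulVec v ∈ U)
    (h0 : (Pi.single 0 1 : Fin (d + 1) → F) ∈ U) : U = ⊤ := by
  have key : ∀ k (hk : k < d + 1), (Pi.single ⟨k, hk⟩ 1 : Fin (d + 1) → F) ∈ U := by
    intro k
    induction k with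
    | zero => intro _; exact h0
    | succ k ih =>
      intro hk
      have h1 := ih (by omega)
      have h2 := U.sub_mem (hU _ h1) (U.smul_mem (θ k) h1)
      convert h2 using 1
      ext i
      simp only [Matrix.mulVec_single_one, Matrix.col_apply, Matrix.of_apply, Pi.sub_apply,
        Pi.smul_apply, Pi.single_apply, Fin.ext_iff, smul_eq_mul]
      split_ifs <;> first | omega | simp_all
  rw [eq_top_iff]
  intro x _
  rw [pi_eq_sum_univ' x]
  refine U.sum_mem fun i _ => U.smul_mem _ ?_
  convert key i i.2 using 1

open Finset in
/-- The left eigenvector coefficients. -/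
def lefF {F : Type*} [Field F] (θ φ : ℕ → F) (k i : ℕ) : F :=
  (∏ l ∈ Ico i k, (θ 0 - θ (l + 1))) * ∏ l ∈ range i, φ (l + 1)

open Finset in
theorem lefF_step {F : Type*} [Field F] (θ φ : ℕ → F) (k i : ℕ) (h : i < k) :
    lefF θ φ k i * φ (i + 1) = (θ 0 - θ (i + 1)) * lefF θ φ k (i + 1) := by
  unfold lefF
  rw [prod_range_succ, prod_eq_prod_Ico_succ_bot h]
  ring

open Finset in
theorem lefF_succ {F : Type*} [Field F] (θ φ : ℕ → F) (k i : ℕ) (h : i ≤ k) :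
    lefF θ φ (k + 1) i = (θ 0 - θ (k + 1)) * lefF θ φ k i := by
  unfold lefF
  rw [prod_Ico_succ_top h]
  ring

open Finset in
theorem lefF_tele {F : Type*} [Field F] (θ φ : ℕ → F) (k : ℕ) (x : ℕ → F) :
    ∑ i ∈ range (k + 1), lefF θ φ k i * (θ i * x i + φ (i + 1) * x (i + 1) - θ (k + 1) * x i) =
    ∑ i ∈ range (k + 2), lefF θ φ (k + 1) i * x i := by
  have key : ∀ n ≤ k, ∑ i ∈ range (n + 1),
      lefF θ φ k i * (θ i * x i + φ (i + 1) * x (i + 1) - θ (k + 1) * x i) =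
      ∑ i ∈ range (n + 1), lefF θ φ (k + 1) i * x i +
        lefF θ φ k n * φ (n + 1) * x (n + 1) := by
    intro n
    induction n with
    | zero =>
      intro _
      simp only [zero_add, sum_range_one]
      rw [lefF_succ θ φ k 0 (by omega)]
      ring
    | succ n ih =>
      intro hn
      rw [sum_range_succ, ih (by omega), sum_range_succ _ (n + 1), lefF_step θ φ k n (by omega),
        lefF_succ θ φ k (n + 1) hn]
      ring
  rw [key k le_rfl, sum_range_succ _ (k + 1)]
  congr 2
  simp [lefF, prod_range_succ]

open Finset in
theorem v0_mem {F : Type*} [Field F] {d : ℕ} (θ φ : ℕ → F) (U : Submodule F (Fin (d + 1) → F))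
    (hU : ∀ v ∈ U, (Matrix.of fun i j : Fin (d + 1) =>
      if (i : ℕ) = (j : ℕ) then θ i else
        if (j : ℕ) = (i : ℕ) + 1 then φ j else 0).mulVec v ∈ U) (k : ℕ) (hk : k ≤ d) :
    ∀ u ∈ U, (∀ i, k < i → vext u i = 0) →
      (∑ i ∈ range (k + 1), lefF θ φ k i * vext u i) • (Pi.single 0 1 : Fin (d + 1) → F) ∈ U := by
  induction k with
  | zero =>
    intro u hu h
    convert hu using 1
    ext i
    by_cases hi : i = 0
    · subst hi
      simp [lefF, vext]
    · rw [← vext_coe u i, h i (Nat.pos_of_ne_zero fun h' => hi (Fin.ext h'))]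
      simp [hi]
  | succ k ih =>
    intro u hu h
    have hm := U.sub_mem (hU _ hu) (U.smul_mem (θ (k + 1)) hu)
    have hv : ∀ i < d + 1, vext ((Matrix.of fun i j : Fin (d + 1) =>
      if (i : ℕ) = (j : ℕ) then θ i else
        if (j : ℕ) = (i : ℕ) + 1 then φ j else 0).mulVec u - θ (k + 1) • u) i =
        θ i * vext u i + φ (i + 1) * vext u (i + 1) - θ (k + 1) * vext u i := by
      intro i hi
      rw [← vext_B θ φ u i hi]
      simp [vext, hi]
    have := ih (by omega) _ hm (by
      intro i hi
      by_cases hid : i < d + 1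
      · rw [hv i hid, h (i + 1) (by omega)]
        rcases (show k + 1 ≤ i from hi).eq_or_lt with rfl | h'
        · ring
        · rw [h i h']; ring
      · simp [vext, hid])
    rw [sum_congr rfl (fun i hi => by rw [hv i (by have := mem_range.1 hi; omega)]),
      lefF_tele] at this
    exact this


/-- Irreducibility of the Racah module `R_d(a,b,c)`: under the genericity
conditions, the bidiagonal matrices `A` and `B` have no common invariant
subspace other than `{0}` and `F^{d+1}`. -/
theorem stmt_15 {F : Type*} [Field F] [IsAlgClosed F] [CharZero F]
    (d : ℕ) (a b c : F)
    (A B : Matrix (Fin (d + 1)) (Fin (d + 1)) F)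
    (hA : A = Matrix.of fun i j : Fin (d + 1) =>
      if (i : ℕ) = (j : ℕ) then
        (a + (d : F) / 2 - (i : ℕ)) * (a + (d : F) / 2 - (i : ℕ) + 1)
      else if (i : ℕ) = (j : ℕ) + 1 then 1 else 0)
    (hB : B = Matrix.of fun i j : Fin (d + 1) =>
      if (i : ℕ) = (j : ℕ) then
        (b + (d : F) / 2 - (i : ℕ)) * (b + (d : F) / 2 - (i : ℕ) + 1)
      else if (j : ℕ) = (i : ℕ) + 1 then
        ((j : ℕ) : F) * (((j : ℕ) : F) - (d : F) - 1) *
          (a + b + c + (d : F) / 2 - ((j : ℕ) : F) + 2) *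
          (a + b - c + (d : F) / 2 - ((j : ℕ) : F) + 1)
      else 0)
    (hgen : ∀ i : ℕ, 1 ≤ i → i ≤ d →
      a + b + c + 1 ≠ (d : F) / 2 - (i : F) ∧
      -a + b + c ≠ (d : F) / 2 - (i : F) ∧
      a - b + c ≠ (d : F) / 2 - (i : F) ∧
      a + b - c ≠ (d : F) / 2 - (i : F)) :
    ∀ U : Submodule F (Fin (d + 1) → F),
      (∀ v ∈ U, A.mulVec v ∈ U) → (∀ v ∈ U, B.mulVec v ∈ U) →
      U = ⊥ ∨ U = ⊤ := by
  intro U hUA hUB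
  by_cases hbot : U = ⊥
  · exact Or.inl hbot
  right
  set θ : ℕ → F := fun i => (a + (d : F) / 2 - i) * (a + (d : F) / 2 - i + 1) with hθ
  set σ : ℕ → F := fun i => (b + (d : F) / 2 - i) * (b + (d : F) / 2 - i + 1) with hσ
  set φ : ℕ → F := fun j => (j : F) * ((j : F) - (d : F) - 1) *
          (a + b + c + (d : F) / 2 - (j : F) + 2) *
          (a + b - c + (d : F) / 2 - (j : F) + 1) with hφ
  have hUA' : ∀ v ∈ U, (Matrix.of fun i j : Fin (d + 1) =>
      if (i : ℕ) = (j : ℕ) then θ i else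
        if (i : ℕ) = (j : ℕ) + 1 then (1 : F) else 0).mulVec v ∈ U := by
    intro v hv; have := hUA v hv; rw [hA] at this; exact this
  have hUB' : ∀ v ∈ U, (Matrix.of fun i j : Fin (d + 1) =>
      if (i : ℕ) = (j : ℕ) then σ i else
        if (j : ℕ) = (i : ℕ) + 1 then φ j else 0).mulVec v ∈ U := by
    intro v hv; have := hUB v hv; rw [hB] at this; exact this
  have hA' : A = (Matrix.of fun i j : Fin (d + 1) =>
      if (i : ℕ) = (j : ℕ) then θ i else
        if (i : ℕ) = (j : ℕ) + 1 then (1 : F) else 0) := hA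
  obtain ⟨w, μ, hwU, hw0, hwA⟩ : ∃ w : Fin (d + 1) → F, ∃ μ : F, w ∈ U ∧ w ≠ 0 ∧
      A.mulVec w = μ • w := by
    have : Nontrivial U := Submodule.nontrivial_iff_ne_bot.2 hbot
    obtain ⟨μ, hμ⟩ := Module.End.exists_eigenvalue
      ((Matrix.mulVecLin A).restrict (p := U) (q := U) (fun v hv => hUA v hv))
    obtain ⟨w, hw⟩ := hμ.exists_hasEigenvector
    refine ⟨w, μ, w.2, fun h => hw.2 (Subtype.ext h), ?_⟩
    have := congrArg Subtype.val hw.apply_eq_smul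
    exact this
  have hrec : ∀ i < d + 1, θ i * vext w i + (if i = 0 then 0 else vext w (i - 1)) =
      μ * vext w i := by
    intro i hi
    rw [← vext_A θ w i hi, ← hA', hwA]
    simp [vext, hi]
  have hex : ∃ j, vext w j ≠ 0 := by
    obtain ⟨j, hj⟩ := Function.ne_iff.1 hw0
    exact ⟨j, by rw [vext_coe]; exact hj⟩
  classical
  obtain ⟨j, hj, hjmin⟩ : ∃ j, vext w j ≠ 0 ∧ ∀ i < j, vext w i = 0 :=
    ⟨Nat.find hex, Nat.find_spec hex, fun i hi => not_not.1 (Nat.find_min hex hi)⟩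
  have hjd : j < d + 1 := by
    by_contra h
    exact hj (by simp [vext, h])
  have hμ : μ = θ j := by
    have := hrec j hjd
    have h0 : (if j = 0 then 0 else vext w (j - 1)) = 0 := by
      split_ifs with h
      · rfl
      · exact hjmin _ (by omega)
    rw [h0, add_zero] at this
    exact (mul_right_cancel₀ hj this).symm
  have hstep : ∀ i, i < d → vext w i = (θ j - θ (i + 1)) * vext w (i + 1) := by
    intro i hi
    have := hrec (i + 1) (by omega)
    simp only [Nat.succ_ne_zero, if_false, Nat.add_sub_cancel, hμ] at this
    linear_combination this
  have hwne : ∀ i, j ≤ i → i ≤ d → vext w i ≠ 0 := by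
    intro i hji
    induction i, hji using Nat.le_induction with
    | base => intro _; exact hj
    | succ i hi ih =>
      intro hid h
      exact ih (by omega) (by rw [hstep i (by omega), h, mul_zero])
  have hφne : ∀ i, 1 ≤ i → i ≤ d → φ i ≠ 0 := by
    intro i hi hid
    have hg := hgen (d + 1 - i) (by omega) (by omega)
    rw [Nat.cast_sub (by omega)] at hg
    push_cast at hg
    simp only [hφ]
    refine mul_ne_zero (mul_ne_zero (mul_ne_zero ?_ ?_) ?_) ?_
    · exact_mod_cast (by omega : i ≠ 0)
    · intro h
      have : (i : F) = ((d + 1 : ℕ) : F) := by push_cast; linear_combination h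
      have := Nat.cast_injective this
      omega
    · intro h; apply hg.1; linear_combination h
    · intro h; apply hg.2.2.2; linear_combination h
  obtain ⟨n, rfl⟩ : ∃ n, d = j + n := ⟨d - j, by omega⟩
  have hmem := v0_mem σ φ U hUB' (j + n) le_rfl w hwU (fun i hi => by
    have : ¬ i < j + n + 1 := by omega
    simp [vext, this])
  refine top_of_v0 θ U hUA' ?_
  have hsum : ∑ i ∈ Finset.range (j + n + 1), lefF σ φ (j + n) i * vext w i ≠ 0 := by
    rw [add_assoc, Finset.sum_range_add, Finset.sum_eq_zero (fun i hi => by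
      rw [hjmin i (Finset.mem_range.1 hi), mul_zero]), zero_add, ← Finset.sum_range_reflect]
    have hpc : ∀ m < n, ((n - m : ℕ) : F) = n - m := fun m hm => Nat.cast_sub hm.le
    apply saal_ne_zero (2 * b + 1) (2 * a + 1 - j) (a + b + c - ((j + n : ℕ) : F) / 2 + 2)
      (a + b - c + ((j + n : ℕ) : F) / 2 - j)
    · push_cast; ring
    · simp only [Nat.add_sub_cancel, Nat.sub_zero]
      refine mul_ne_zero ?_ (hwne _ (by omega) (by omega))
      simp only [lefF, Finset.Ico_self, Finset.prod_empty, one_mul]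
      rw [Finset.prod_ne_zero_iff]
      intro l hl
      have := Finset.mem_range.1 hl
      exact hφne _ (by omega) (by omega)
    · intro m hm
      obtain ⟨r, rfl⟩ : ∃ r, n = m + 1 + r := ⟨n - (m + 1), by omega⟩
      have e1 : j + (m + 1 + r + 1 - 1 - (m + 1)) = j + r := by omega
      have e2 : j + (m + 1 + r + 1 - 1 - m) = j + r + 1 := by omega
      rw [e1, e2, hstep (j + r) (by omega)]
      have e3 := lefF_step σ φ (j + (m + 1 + r)) (j + r) (by omega)
      have hne : ((j + r + 1 : ℕ) : F) ≠ 0 := Nat.cast_ne_zero.2 (by omega)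
      apply mul_left_cancel₀ hne
      generalize lefF σ φ (j + (m + 1 + r)) (j + r) = X at *
      generalize lefF σ φ (j + (m + 1 + r)) (j + r + 1) = Y at *
      generalize vext w (j + r + 1) = Z at *
      simp only [hφ, hσ] at e3
      simp only [hθ]
      push_cast at e3 ⊢
      linear_combination (-(r + 1) * (2 * a + 1 - j + m) * Z) * e3
    · intro m hm h
      apply (hgen (m + 1) (by omega) (by omega)).1
      push_cast at h ⊢; linear_combination h
    · intro m hm h
      apply (hgen (n - m) (by omega) (by omega)).2.2.2
      rw [hpc m hm]
      push_cast at h ⊢; linear_combination h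
    · intro m hm h
      apply (hgen (m + 1) (by omega) (by omega)).2.2.1
      push_cast at h ⊢; linear_combination h
    · intro m hm h
      apply (hgen (j + m + 1) (by omega) (by omega)).2.1
      push_cast at h ⊢; linear_combination h
  have := U.smul_mem (∑ i ∈ Finset.range (j + n + 1), lefF σ φ (j + n) i * vext w i)⁻¹ hmem
  rwa [smul_smul, inv_mul_cancel₀ hsum, one_smul] at this
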